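/- arXiv:1812.08637 — 4 statements merged into one kernel-verified Lean document; each statement's English description precedes it below -/
import Mathlib

section
/- Fix L > 0 and κ₀ ∈ ℝ, set κ_j = κ₀ + 2jπ/L for j ∈ ℤ and γ^{±1/2} = exp(±iκ₀L/2). Let u₀ : [0,L] → ℂ be integrable and define φ, ψ : [0,L] → ℂ by φ(x) = γ^{−1/2} u₀(x + L/2) for 0 ≤ x ≤ L/2 and φ(x) = γ^{1/2} u₀(x − L/2) for L/2 < x ≤ L, and ψ(x) = γ^{1/2} u₀(x + L/2) for 0 ≤ x ≤ L/2 and ψ(x) = γ^{−1/2} u₀(x − L/2) for L/2 < x ≤ L. Then for every j ∈ ℤ, ∫₀^L e^{−iκ_j x} φ(x) dx = (−1)^j ∫₀^L e^{−iκ_j x} u₀(x) dx and ∫₀^L e^{iκ_j x} ψ(x) dx = (−1)^j ∫₀^L e^{iκ_j x} u₀(x) dx. -/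
open MeasureTheory

/-- Swapping the two halves of `[0, 2a]` and scaling by `c` scales the integral by `c`. -/
theorem intervalIntegral_half_swap {a : ℝ} (ha : 0 ≤ a) {c : ℂ} {g h : ℝ → ℂ}
    (hh : IntervalIntegrable h volume 0 (2 * a))
    (hg₁ : ∀ x ∈ Set.Ioc 0 a, g x = c * h (x + a))
    (hg₂ : ∀ x ∈ Set.Ioc a (2 * a), g x = c * h (x - a)) :
    ∫ x in (0:ℝ)..(2 * a), g x = c * ∫ x in (0:ℝ)..(2 * a), h x := by
  have ha2 : a ≤ 2 * a := by linarith
  have hmem : a ∈ Set.uIcc 0 (2 * a) := Set.mem_uIcc_of_le ha ha2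
  have h₁ : IntervalIntegrable h volume 0 a :=
    hh.mono_set (Set.uIcc_subset_uIcc Set.left_mem_uIcc hmem)
  have h₂ : IntervalIntegrable h volume a (2 * a) :=
    hh.mono_set (Set.uIcc_subset_uIcc hmem Set.right_mem_uIcc)
  have hs₁ : IntervalIntegrable (fun x => c * h (x + a)) volume 0 a := by
    have := (h₂.comp_add_right a).const_mul c
    rwa [sub_self, show 2 * a - a = a by ring] at this
  have hs₂ : IntervalIntegrable (fun x => c * h (x - a)) volume a (2 * a) := by
    have := (h₁.comp_sub_right a).const_mul c
    rwa [zero_add, ← two_mul] at this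
  have e₁ : Set.EqOn (fun x => c * h (x + a)) g (Set.uIoc 0 a) := fun x hx =>
    (hg₁ x (by rwa [Set.uIoc_of_le ha] at hx)).symm
  have e₂ : Set.EqOn (fun x => c * h (x - a)) g (Set.uIoc a (2 * a)) := fun x hx =>
    (hg₂ x (by rwa [Set.uIoc_of_le ha2] at hx)).symm
  rw [← intervalIntegral.integral_add_adjacent_intervals (hs₁.congr e₁) (hs₂.congr e₂),
    ← intervalIntegral.integral_congr_ae (ae_of_all _ e₁),
    ← intervalIntegral.integral_congr_ae (ae_of_all _ e₂),
    intervalIntegral.integral_const_mul, intervalIntegral.integral_const_mul,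
    intervalIntegral.integral_comp_add_right, intervalIntegral.integral_comp_sub_right,
    ← intervalIntegral.integral_add_adjacent_intervals h₁ h₂, zero_add, sub_self,
    ← two_mul, show 2 * a - a = a by ring]
  ring

/-- An exponentially weighted half-shift acts on the exponential transform at `s` by the scalar
`c = exp (w - s L / 2)`, provided `c` also equals `exp (s L / 2 - w)`. -/
theorem integral_exp_mul_half_shift {L : ℝ} (hL : 0 < L) {u f e : ℝ → ℂ} {s w c : ℂ}
    (he : ∀ x : ℝ, e x = Complex.exp (s * x))
    (hu : IntegrableOn u (Set.Icc 0 L))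
    (hf₁ : ∀ x : ℝ, 0 ≤ x → x ≤ L / 2 → f x = Complex.exp w * u (x + L / 2))
    (hf₂ : ∀ x : ℝ, L / 2 < x → x ≤ L → f x = Complex.exp (-w) * u (x - L / 2))
    (hc₁ : Complex.exp (w - s * (L / 2)) = c) (hc₂ : Complex.exp (s * (L / 2) - w) = c) :
    ∫ x in (0:ℝ)..L, e x * f x = c * ∫ x in (0:ℝ)..L, e x * u x := by
  obtain rfl : e = fun x : ℝ => Complex.exp (s * x) := funext he
  have hL2 : 2 * (L / 2) = L := by ring
  have hint : IntervalIntegrable (fun x : ℝ => Complex.exp (s * x) * u x) volume 0 L :=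
    ((intervalIntegrable_iff_integrableOn_Icc_of_le hL.le).2 hu).continuousOn_mul
      (by fun_prop)
  have key := intervalIntegral_half_swap (a := L / 2) (c := c)
    (g := fun x : ℝ => Complex.exp (s * x) * f x)
    (h := fun x : ℝ => Complex.exp (s * x) * u x) (by positivity) (by rwa [hL2])
  rw [hL2] at key
  refine key (fun x hx => ?_) (fun x hx => ?_)
  · rw [hf₁ x hx.1.le hx.2, ← hc₁, ← mul_assoc, ← mul_assoc, ← Complex.exp_add,
      ← Complex.exp_add]
    congr 2
    push_cast
    ring
  · rw [hf₂ x hx.1 hx.2, ← hc₂, ← mul_assoc, ← mul_assoc, ← Complex.exp_add,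
      ← Complex.exp_add]
    congr 2
    push_cast
    ring

theorem exp_int_mul_pi_mul_I (j : ℤ) : Complex.exp (j * (Real.pi * Complex.I)) = (-1) ^ j := by
  rw [Complex.exp_int_mul, Complex.exp_pi_mul_I]

theorem exp_neg_int_mul_pi_mul_I (j : ℤ) :
    Complex.exp (-(j * (Real.pi * Complex.I))) = (-1) ^ j := by
  rw [Complex.exp_neg, exp_int_mul_pi_mul_I, ← inv_zpow, inv_neg_one]

/-- Half-interval shift computation for odd integer times (`q = 1`, `p` odd):
the `γ^{±1/2}`-weighted half-shifts `φ, ψ` of the initial datum satisfy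
`φ̂(κ_j) = (−1)^j û₀(κ_j)` and `ψ̂(−κ_j) = (−1)^j û₀(−κ_j)`. -/
theorem half_shift_fourier (L : ℝ) (hL : 0 < L) (κ₀ : ℝ)
    (u₀ : ℝ → ℂ) (hu₀ : IntegrableOn u₀ (Set.Icc (0:ℝ) L))
    (φ ψ : ℝ → ℂ)
    (hφ1 : ∀ x : ℝ, 0 ≤ x → x ≤ L / 2 →
      φ x = Complex.exp (-(Complex.I * ((κ₀ * L / 2 : ℝ) : ℂ))) * u₀ (x + L / 2))
    (hφ2 : ∀ x : ℝ, L / 2 < x → x ≤ L →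
      φ x = Complex.exp (Complex.I * ((κ₀ * L / 2 : ℝ) : ℂ)) * u₀ (x - L / 2))
    (hψ1 : ∀ x : ℝ, 0 ≤ x → x ≤ L / 2 →
      ψ x = Complex.exp (Complex.I * ((κ₀ * L / 2 : ℝ) : ℂ)) * u₀ (x + L / 2))
    (hψ2 : ∀ x : ℝ, L / 2 < x → x ≤ L →
      ψ x = Complex.exp (-(Complex.I * ((κ₀ * L / 2 : ℝ) : ℂ))) * u₀ (x - L / 2)) :
    ∀ j : ℤ,
      (∫ x in (0:ℝ)..L,
          Complex.exp (-(Complex.I * ((κ₀ + 2 * (j : ℝ) * Real.pi / L : ℝ) : ℂ) * (x : ℂ))) *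
            φ x) =
        (-1 : ℂ) ^ j *
          ∫ x in (0:ℝ)..L,
            Complex.exp (-(Complex.I * ((κ₀ + 2 * (j : ℝ) * Real.pi / L : ℝ) : ℂ) * (x : ℂ))) *
              u₀ x ∧
      (∫ x in (0:ℝ)..L,
          Complex.exp (Complex.I * ((κ₀ + 2 * (j : ℝ) * Real.pi / L : ℝ) : ℂ) * (x : ℂ)) *
            ψ x) =
        (-1 : ℂ) ^ j *
          ∫ x in (0:ℝ)..L,
            Complex.exp (Complex.I * ((κ₀ + 2 * (j : ℝ) * Real.pi / L : ℝ) : ℂ) * (x : ℂ)) *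
              u₀ x := by
  intro j
  have hL0 : (L : ℂ) ≠ 0 := by exact_mod_cast hL.ne'
  set k : ℂ := ((κ₀ + 2 * (j : ℝ) * Real.pi / L : ℝ) : ℂ) with hk
  set g : ℂ := ((κ₀ * L / 2 : ℝ) : ℂ) with hg
  have hshift : Complex.I * k * (L / 2) - Complex.I * g = j * (Real.pi * Complex.I) := by
    rw [hk, hg]
    push_cast
    field_simp
    ring
  constructor
  · refine integral_exp_mul_half_shift hL (s := -(Complex.I * k)) (w := -(Complex.I * g))
      (fun x => by rw [neg_mul]) hu₀ hφ1 (by simpa only [neg_neg] using hφ2) ?_ ?_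
    · rw [← exp_int_mul_pi_mul_I, ← hshift]
      congr 1
      ring
    · rw [← exp_neg_int_mul_pi_mul_I, ← hshift]
      congr 1
      ring
  · refine integral_exp_mul_half_shift hL (s := Complex.I * k) (w := Complex.I * g)
      (fun x => rfl) hu₀ hψ1 hψ2 ?_ ?_
    · rw [← exp_neg_int_mul_pi_mul_I, ← hshift]
      congr 1
      ring
    · rw [← exp_int_mul_pi_mul_I, ← hshift]
end

section
/- Fix L > 0 and β₀, β₁ ∈ ℂ with β₀ + β₁ ≠ 0. Let κ ∈ ℂ satisfy 2(β₀ + β₁)cos(κL) = 2(1 + β₀β₁) and sin(κL) ≠ 0, set γ = exp(iκL), and assume β₀ ≠ γ⁻¹. Define X : ℝ → ℂ by X(x) = e^{iκx} + ((γ − β₀)/(β₀ − γ⁻¹)) e^{−iκx}. Then X''(x) + κ²X(x) = 0 for all x ∈ ℝ, β₀X(0) = X(L), and β₁X'(0) = X'(L). -/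
theorem deriv_exp_add_mul_exp_neg (c a b : ℂ) :
    deriv (fun x : ℝ => a * Complex.exp (c * (x : ℂ)) + b * Complex.exp (-(c * (x : ℂ)))) =
      fun x : ℝ =>
        (c * a) * Complex.exp (c * (x : ℂ)) + (-(c * b)) * Complex.exp (-(c * (x : ℂ))) := by
  funext x
  have hlin : HasDerivAt (fun x : ℝ => c * (x : ℂ)) c x := by
    simpa using (Complex.ofRealCLM.hasDerivAt (x := x)).const_mul c
  have h := (hlin.cexp.const_mul a).add (hlin.fun_neg.cexp.const_mul b)
  exact h.deriv.trans (by ring)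

/-- At each zero `κ` of the discriminant with `sin(κL) ≠ 0`, the function
`X(x) = e^{iκx} + ((γ−β₀)/(β₀−γ⁻¹)) e^{−iκx}`, with `γ = e^{iκL}`, is an
eigenfunction of the pseudoperiodic eigenvalue problem. -/
theorem pseudoperiodic_eigenfunction (L : ℝ) (hL : 0 < L) (β₀ β₁ : ℂ)
    (hs : β₀ + β₁ ≠ 0) (κ : ℂ)
    (hκ : 2 * (β₀ + β₁) * Complex.cos (κ * (L : ℂ)) = 2 * (1 + β₀ * β₁))
    (hsin : Complex.sin (κ * (L : ℂ)) ≠ 0)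
    (γ : ℂ) (hγ : γ = Complex.exp (Complex.I * κ * (L : ℂ)))
    (hβ : β₀ ≠ γ⁻¹)
    (X : ℝ → ℂ)
    (hX : ∀ x : ℝ, X x = Complex.exp (Complex.I * κ * (x : ℂ)) +
      ((γ - β₀) / (β₀ - γ⁻¹)) * Complex.exp (-(Complex.I * κ * (x : ℂ)))) :
    (∀ x : ℝ, deriv (deriv X) x + κ ^ 2 * X x = 0) ∧
      β₀ * X 0 = X L ∧ β₁ * deriv X 0 = deriv X L := by
  have hX' : X = fun x : ℝ => 1 * Complex.exp (Complex.I * κ * (x : ℂ)) +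
      ((γ - β₀) / (β₀ - γ⁻¹)) * Complex.exp (-(Complex.I * κ * (x : ℂ))) := by
    funext x
    rw [hX, one_mul]
  have hne : β₀ - γ⁻¹ ≠ 0 := sub_ne_zero.mpr hβ
  have hγ0 : γ ≠ 0 := hγ ▸ Complex.exp_ne_zero _
  have hA : (γ - β₀) / (β₀ - γ⁻¹) * (β₀ - γ⁻¹) = γ - β₀ := div_mul_cancel₀ _ hne
  have hinv : Complex.exp (-(Complex.I * κ * (L : ℂ))) = γ⁻¹ := by rw [Complex.exp_neg, hγ]
  have hcos : 2 * Complex.cos (κ * (L : ℂ)) = γ + γ⁻¹ := by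
    rw [Complex.two_cos, ← hinv, hγ]
    ring_nf
  have hmul : γ * γ⁻¹ = 1 := mul_inv_cancel₀ hγ0
  rw [hX', deriv_exp_add_mul_exp_neg, deriv_exp_add_mul_exp_neg]
  generalize (γ - β₀) / (β₀ - γ⁻¹) = A at hA ⊢
  simp only [hinv, ← hγ, Complex.ofReal_zero, mul_zero, neg_zero, Complex.exp_zero]
  refine ⟨fun x => ?_, ?_, ?_⟩
  · linear_combination (κ ^ 2 * Complex.exp (Complex.I * κ * (x : ℂ)) +
      κ ^ 2 * A * Complex.exp (-(Complex.I * κ * (x : ℂ)))) * Complex.I_sq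
  · linear_combination hA
  · have hslope : β₁ * (1 - A) = γ - A * γ⁻¹ := by
      apply mul_right_cancel₀ hne
      linear_combination (γ⁻¹ - β₁) * hA + (β₀ + β₁) * hcos - hκ + 2 * hmul
    linear_combination Complex.I * κ * hslope
end

section
/- Fix L > 0 and β₀, β₁ ∈ ℂ with β₀β₁ ≠ 0 and β₀ + β₁ ≠ 0. Let κ₀ ∈ ℝ satisfy cos(κ₀L) = (1 + β₀β₁)/(β₀ + β₁) and sin(κ₀L) ≠ 0, set γ = exp(iκ₀L) and κ_j = κ₀ + 2jπ/L for j ∈ ℤ, and assume β₀γ ≠ 1, β₁γ ≠ 1 and 1/conj(β₁) ≠ γ⁻¹. For j, k ∈ ℤ define X_j(x) = e^{iκ_j x} + ((γ − β₀)/(β₀ − γ⁻¹)) e^{−iκ_j x} and Y_k(x) = e^{iκ_k x} + ((γ − 1/conj(β₁))/(1/conj(β₁) − γ⁻¹)) e^{−iκ_k x}. Then (1/L)∫₀^L X_j(x)·conj(Y_k(x)) dx = 0 whenever j ≠ k, and (1/L)∫₀^L X_j(x)·conj(Y_j(x)) dx = τ for every j, where τ = ((1 + β₀β₁)(γ² +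 1) − 2γ(β₀ + β₁)) / ((β₀γ − 1)(β₁γ − 1)). -/
open MeasureTheory

/-- The integral of a product of two sums of exponentials, expanded into four terms. -/
theorem integral_exp_pair_mul (L : ℝ) (a b A B : ℂ) :
    ∫ x in (0:ℝ)..L, (Complex.exp (a * x) + A * Complex.exp (-(a * x))) *
        (Complex.exp (-(b * x)) + B * Complex.exp (b * x)) =
      (∫ x in (0:ℝ)..L, Complex.exp ((a - b) * x)) +
        A * B * (∫ x in (0:ℝ)..L, Complex.exp (-(a - b) * x)) +
        (A * (∫ x in (0:ℝ)..L, Complex.exp (-(a + b) * x)) +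
          B * ∫ x in (0:ℝ)..L, Complex.exp ((a + b) * x)) := by
  have hi (c d : ℂ) : IntervalIntegrable (fun x : ℝ => d * Complex.exp (c * x)) volume 0 L :=
    Continuous.intervalIntegrable (by fun_prop) _ _
  have hi' (c : ℂ) : IntervalIntegrable (fun x : ℝ => Complex.exp (c * x)) volume 0 L :=
    Continuous.intervalIntegrable (by fun_prop) _ _
  simp only [← intervalIntegral.integral_const_mul]
  rw [← intervalIntegral.integral_add (hi' _) (hi _ _),
    ← intervalIntegral.integral_add (hi _ _) (hi _ _),
    ← intervalIntegral.integral_add ((hi' _).add (hi _ _)) ((hi _ _).add (hi _ _))]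
  refine intervalIntegral.integral_congr fun x _ => ?_
  simp only [add_mul, neg_mul, neg_add, sub_eq_add_neg, Complex.exp_add]
  ring_nf

theorem integral_exp_mul_eq_zero {L : ℝ} {c : ℂ} (hc : c ≠ 0) (h : Complex.exp (c * L) = 1) :
    ∫ x in (0:ℝ)..L, Complex.exp (c * x) = 0 := by
  rw [integral_exp_mul_complex hc, h]
  simp

/-- Biorthogonality of the eigenfunctions `X_j` of the pseudoperiodic problem and
the eigenfunctions `Y_k` of the adjoint problem: `⟨X_j, Y_k⟩ = τ δ_{jk}`. -/
theorem biorthogonality (L : ℝ) (hL : 0 < L) (β₀ β₁ : ℂ)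
    (hβ01 : β₀ * β₁ ≠ 0) (hs : β₀ + β₁ ≠ 0) (κ₀ : ℝ)
    (hcos : Complex.cos ((κ₀ : ℂ) * (L : ℂ)) = (1 + β₀ * β₁) / (β₀ + β₁))
    (hsin : Complex.sin ((κ₀ : ℂ) * (L : ℂ)) ≠ 0)
    (γ : ℂ) (hγ : γ = Complex.exp (Complex.I * (κ₀ : ℂ) * (L : ℂ)))
    (h1 : β₀ * γ ≠ 1) (h2 : β₁ * γ ≠ 1)
    (h3 : 1 / (starRingEnd ℂ) β₁ ≠ γ⁻¹)
    (X Y : ℤ → ℝ → ℂ)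
    (hX : ∀ (j : ℤ) (x : ℝ), X j x =
      Complex.exp (Complex.I * ((κ₀ + 2 * (j : ℝ) * Real.pi / L : ℝ) : ℂ) * (x : ℂ)) +
        ((γ - β₀) / (β₀ - γ⁻¹)) *
          Complex.exp (-(Complex.I * ((κ₀ + 2 * (j : ℝ) * Real.pi / L : ℝ) : ℂ) * (x : ℂ))))
    (hY : ∀ (k : ℤ) (x : ℝ), Y k x =
      Complex.exp (Complex.I * ((κ₀ + 2 * (k : ℝ) * Real.pi / L : ℝ) : ℂ) * (x : ℂ)) +
        ((γ - 1 / (starRingEnd ℂ) β₁) / (1 / (starRingEnd ℂ) β₁ - γ⁻¹)) *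
          Complex.exp (-(Complex.I * ((κ₀ + 2 * (k : ℝ) * Real.pi / L : ℝ) : ℂ) * (x : ℂ)))) :
    (∀ j k : ℤ, j ≠ k →
      (1 / (L : ℂ)) * ∫ x in (0:ℝ)..L, X j x * (starRingEnd ℂ) (Y k x) = 0) ∧
    (∀ j : ℤ,
      (1 / (L : ℂ)) * ∫ x in (0:ℝ)..L, X j x * (starRingEnd ℂ) (Y j x) =
        ((1 + β₀ * β₁) * (γ ^ 2 + 1) - 2 * γ * (β₀ + β₁)) /
          ((β₀ * γ - 1) * (β₁ * γ - 1))) := by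
  have hL' : (L : ℂ) ≠ 0 := by exact_mod_cast hL.ne'
  have hγ0 : γ ≠ 0 := hγ ▸ Complex.exp_ne_zero _
  have hγc : (starRingEnd ℂ) γ = γ⁻¹ := by
    rw [hγ, ← Complex.exp_conj, ← Complex.exp_neg]
    simp
  have hβ₁ : β₁ ≠ 0 := right_ne_zero_of_mul hβ01
  have hd0 : β₀ * γ - 1 ≠ 0 := sub_ne_zero.mpr h1
  have hd1 : β₁ * γ - 1 ≠ 0 := sub_ne_zero.mpr h2
  have hchar : (γ ^ 2 + 1) * (β₀ + β₁) = 2 * γ * (1 + β₀ * β₁) := by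
    have hc : Complex.cos ((κ₀ : ℂ) * L) = (γ + γ⁻¹) / 2 := by
      rw [Complex.cos, hγ, ← Complex.exp_neg]
      ring_nf
    rw [hc] at hcos
    field_simp at hcos
    linear_combination hcos
  have hA : (γ - β₀) / (β₀ - γ⁻¹) = γ * (γ - β₀) / (β₀ * γ - 1) := by
    have : β₀ - γ⁻¹ = (β₀ * γ - 1) / γ := by field_simp
    rw [this]
    field_simp
  have hB : (starRingEnd ℂ) ((γ - 1 / (starRingEnd ℂ) β₁) / (1 / (starRingEnd ℂ) β₁ - γ⁻¹)) =
      (γ - β₁) / (γ * (β₁ * γ - 1)) := by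
    simp only [map_div₀, map_sub, map_inv₀, map_one, Complex.conj_conj, hγc, inv_inv]
    have e1 : 1 / β₁ - γ = -(β₁ * γ - 1) / β₁ := by field_simp; ring
    rw [e1]
    field_simp
    ring
  set A : ℂ := (γ - β₀) / (β₀ - γ⁻¹) with hAdef
  set B : ℂ := (γ - β₁) / (γ * (β₁ * γ - 1)) with hBdef
  have hcross : A / γ ^ 2 + B = 0 := by
    rw [hA, hBdef]
    generalize hD₀ : β₀ * γ - 1 = D₀ at hd0 ⊢
    generalize hD₁ : β₁ * γ - 1 = D₁ at hd1 ⊢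
    field_simp
    rw [← hD₀, ← hD₁]
    linear_combination hchar
  let c : ℤ → ℂ := fun j => Complex.I * ((κ₀ + 2 * (j : ℝ) * Real.pi / L : ℝ) : ℂ)
  have hcL (j : ℤ) : c j * L = Complex.I * κ₀ * L + j * (2 * Real.pi * Complex.I) := by
    simp only [c]
    push_cast
    field_simp
  have hexp (j : ℤ) : Complex.exp (c j * L) = γ := by
    rw [hcL, Complex.exp_add, Complex.exp_int_mul_two_pi_mul_I, mul_one, hγ]
  have hadd (j k : ℤ) : Complex.exp ((c j + c k) * L) = γ ^ 2 := by
    rw [add_mul, Complex.exp_add, hexp, hexp, sq]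
  have hsub (j k : ℤ) : Complex.exp ((c j - c k) * L) = 1 := by
    rw [sub_mul, Complex.exp_sub, hexp, hexp, div_self hγ0]
  have hγ2 : γ ^ 2 ≠ 1 := by
    intro h
    apply hsin
    have hi : γ⁻¹ = γ := by
      field_simp
      exact h.symm
    have : Complex.sin ((κ₀ : ℂ) * L) = (γ⁻¹ - γ) * Complex.I / 2 := by
      rw [Complex.sin, hγ, ← Complex.exp_neg]
      ring_nf
    rw [this, hi]
    simp
  have hne (j k : ℤ) : c j + c k ≠ 0 := by
    intro h
    have := hadd j k
    rw [h, zero_mul, Complex.exp_zero] at this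
    exact hγ2 this.symm
  have hzero (j k : ℤ) :
      A * (∫ x in (0:ℝ)..L, Complex.exp (-(c j + c k) * x)) +
        B * ∫ x in (0:ℝ)..L, Complex.exp ((c j + c k) * x) = 0 := by
    have hn := hne j k
    rw [integral_exp_mul_complex hn, integral_exp_mul_complex (neg_ne_zero.mpr hn), neg_mul,
      Complex.exp_neg, hadd]
    simp only [Complex.ofReal_zero, mul_zero, Complex.exp_zero]
    have e : A * (((γ ^ 2)⁻¹ - 1) / -(c j + c k)) + B * ((γ ^ 2 - 1) / (c j + c k)) =
        (A / γ ^ 2 + B) * (γ ^ 2 - 1) / (c j + c k) := by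
      field_simp
      ring
    rw [e, hcross]
    simp
  have hint (j k : ℤ) : ∫ x in (0:ℝ)..L, X j x * (starRingEnd ℂ) (Y k x) =
      (∫ x in (0:ℝ)..L, Complex.exp ((c j - c k) * x)) +
        A * B * ∫ x in (0:ℝ)..L, Complex.exp (-(c j - c k) * x) := by
    have h := integral_exp_pair_mul L (c j) (c k) A B
    rw [hzero, add_zero] at h
    rw [← h]
    refine intervalIntegral.integral_congr fun x _ => ?_
    simp only [hX, hY, map_add, map_mul, hB, ← Complex.exp_conj, map_neg, Complex.conj_I,
      Complex.conj_ofReal, neg_mul, neg_neg, c]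
  constructor
  · intro j k hjk
    have hn : c j - c k ≠ 0 := by
      intro h
      have h' : (c j - c k) * L = 0 := by rw [h, zero_mul]
      rw [sub_mul, hcL, hcL, add_sub_add_left_eq_sub, sub_eq_zero] at h'
      exact hjk (by exact_mod_cast mul_right_cancel₀ Complex.two_pi_I_ne_zero h')
    rw [hint, integral_exp_mul_eq_zero hn (hsub j k),
      integral_exp_mul_eq_zero (neg_ne_zero.mpr hn) (by rw [neg_sub, hsub])]
    simp
  · intro j
    rw [hint, hA, hBdef]
    simp only [sub_self, neg_zero, zero_mul, Complex.exp_zero, intervalIntegral.integral_const,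
      sub_zero, Complex.real_smul, mul_one]
    generalize hD₀ : β₀ * γ - 1 = D₀ at hd0 ⊢
    generalize hD₁ : β₁ * γ - 1 = D₁ at hd1 ⊢
    field_simp
    rw [← hD₀, ← hD₁]
    ring
end

section
/- Let β₀, β₁, γ ∈ ℂ satisfy: γ ≠ 0, γ² ≠ 1, β₀ + β₁ ≠ 0, γ + γ⁻¹ = 2(1 + β₀β₁)/(β₀ + β₁), β₀γ ≠ 1, β₁γ ≠ 1, (β₀ + β₁)γ ≠ 2, and τ ≠ 0, where τ = ((1 + β₀β₁)(γ² + 1) − 2γ(β₀ + β₁)) / ((β₀γ − 1)(β₁γ − 1)) and δ = (β₀ − β₁)/(γ((β₀ + β₁)γ − 2)). Then for all E, U₊, U₋ ∈ ℂ with E ≠ 0: (1/τ)·( E + ((γ − β₀)/(β₀ − γ⁻¹))·E⁻¹ )·( U₊ + ((β₁ − γ)/(γ(1 − γβ₁)))·U₋ ) = [ ((β₀ + β₁)γ − 2)·E + (β₁ − β₀)γ·E⁻¹ ] / [ (β₀ + β₁)(γ − γ⁻¹) ] · ( U₊ + δ·U₋ ). -/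
/-- Term-by-term equivalence of the biorthogonal eigenfunction series and the
Unified Transform Method series for the pseudoperiodic problem. -/
theorem series_terms_equivalence (β₀ β₁ γ : ℂ) (hγ0 : γ ≠ 0) (hγ1 : γ ^ 2 ≠ 1)
    (hs : β₀ + β₁ ≠ 0)
    (hrel : γ + γ⁻¹ = 2 * (1 + β₀ * β₁) / (β₀ + β₁))
    (h1 : β₀ * γ ≠ 1) (h2 : β₁ * γ ≠ 1) (h3 : (β₀ + β₁) * γ ≠ 2)
    (τ δ : ℂ)
    (hτ : τ = ((1 + β₀ * β₁) * (γ ^ 2 + 1) - 2 * γ * (β₀ + β₁)) /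
      ((β₀ * γ - 1) * (β₁ * γ - 1)))
    (hτ0 : τ ≠ 0)
    (hδ : δ = (β₀ - β₁) / (γ * ((β₀ + β₁) * γ - 2)))
    (E Uplus Uminus : ℂ) (hE : E ≠ 0) :
    (1 / τ) * (E + ((γ - β₀) / (β₀ - γ⁻¹)) * E⁻¹) *
        (Uplus + ((β₁ - γ) / (γ * (1 - γ * β₁))) * Uminus) =
      (((β₀ + β₁) * γ - 2) * E + (β₁ - β₀) * γ * E⁻¹) / ((β₀ + β₁) * (γ - γ⁻¹)) *
        (Uplus + δ * Uminus) := by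
  have hA : β₀ * γ - 1 ≠ 0 := sub_ne_zero.mpr h1
  have hB : β₁ * γ - 1 ≠ 0 := sub_ne_zero.mpr h2
  have hC : (β₀ + β₁) * γ - 2 ≠ 0 := sub_ne_zero.mpr h3
  have hG : γ ^ 2 - 1 ≠ 0 := sub_ne_zero.mpr hγ1
  have hpoly : (β₀ + β₁) * (γ ^ 2 + 1) = 2 * γ * (1 + β₀ * β₁) := by
    field_simp at hrel
    linear_combination hrel
  have hprod : 2 * ((β₀ * γ - 1) * (β₁ * γ - 1)) = (γ ^ 2 - 1) * ((β₀ + β₁) * γ - 2) := by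
    linear_combination -γ * hpoly
  have hτ' : τ = (β₀ + β₁) * (γ ^ 2 - 1) / (γ * ((β₀ + β₁) * γ - 2)) := by
    rw [hτ, div_eq_div_iff (mul_ne_zero hA hB) (mul_ne_zero hγ0 hC)]
    linear_combination (-((γ ^ 2 + 1) * ((β₀ + β₁) * γ - 2) / 2)) * hpoly -
      (β₀ + β₁) * (γ ^ 2 - 1) / 2 * hprod
  have hreflect : (γ - β₀) / (β₀ - γ⁻¹) = (β₁ - β₀) * γ / ((β₀ + β₁) * γ - 2) := by
    have hden : β₀ - γ⁻¹ = (β₀ * γ - 1) / γ := by field_simp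
    rw [hden, div_div_eq_mul_div, div_eq_div_iff hA hC]
    linear_combination γ * hpoly
  have hadjoint : (β₁ - γ) / (γ * (1 - γ * β₁)) = δ := by
    have hB' : 1 - γ * β₁ ≠ 0 := fun h => hB (by linear_combination -h)
    rw [hδ, div_eq_div_iff (mul_ne_zero hγ0 hB') (mul_ne_zero hγ0 hC)]
    linear_combination -γ * hpoly
  have hγinv : γ - γ⁻¹ = (γ ^ 2 - 1) / γ := by field_simp
  rw [hadjoint, hreflect, hτ', hγinv]
  congr 1
  field_simp
end
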